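/- Let μ ∈ ℝ, σ > 0 and τ_l < τ_u, and let F be the cumulative distribution function of the truncated normal distribution TN(μ,σ,τ_l,τ_u). Then for every t > 0, lim_{x→0⁺} (1 − F(τ_u − t x))/(1 − F(τ_u − x)) = t. (Thus F belongs to the domain of attraction of the Weibull extreme value distribution with index α = 1.) -/

import Mathlib

open Real Filter Topology

/-- The standard normal density `φ(x) = (1/√(2π)) e^{-x²/2}`. -/
noncomputable def stdPhi (x : ℝ) : ℝ := (Real.sqrt (2 * Real.pi))⁻¹ * Real.exp (-(x ^ 2) / 2)

/-- The standard normal cumulative distribution function `Φ`. -/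
noncomputable def stdPhiCDF (x : ℝ) : ℝ := ∫ t in Set.Iic x, stdPhi t

/-- The cumulative distribution function of the truncated normal distribution
`TN(μ,σ,τ_l,τ_u)`: `F(t) = (Φ((t−μ)/σ) − Φ((τ_l−μ)/σ))/(Φ((τ_u−μ)/σ) − Φ((τ_l−μ)/σ))`
for `t ∈ [τ_l, τ_u]`, with `F(t) = 0` for `t < τ_l` and `F(t) = 1` for `t > τ_u`. -/
noncomputable def truncNormalCDF (μ σ τl τu : ℝ) (t : ℝ) : ℝ :=
  if t < τl then 0
  else if τu < t then 1
  else (stdPhiCDF ((t - μ) / σ) - stdPhiCDF ((τl - μ) / σ)) /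
    (stdPhiCDF ((τu - μ) / σ) - stdPhiCDF ((τl - μ) / σ))

lemma stdPhi_pos (x : ℝ) : 0 < stdPhi x := by
  unfold stdPhi
  positivity

lemma continuous_stdPhi : Continuous stdPhi := by
  unfold stdPhi
  fun_prop

lemma integrable_stdPhi : MeasureTheory.Integrable stdPhi := by
  have h := (integrable_exp_neg_mul_sq (b := 1 / 2) (by norm_num)).const_mul
    (Real.sqrt (2 * Real.pi))⁻¹
  refine h.congr (Filter.Eventually.of_forall fun x => ?_)
  simp only [stdPhi]
  ring_nf

lemma stdPhiCDF_sub (a b : ℝ) : stdPhiCDF b - stdPhiCDF a = ∫ t in a..b, stdPhi t :=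
  intervalIntegral.integral_Iic_sub_Iic integrable_stdPhi.integrableOn
    integrable_stdPhi.integrableOn

lemma stdPhiCDF_strictMono : StrictMono stdPhiCDF := fun a b hab => by
  have h := intervalIntegral.intervalIntegral_pos_of_pos
    (continuous_stdPhi.intervalIntegrable a b) stdPhi_pos hab
  rw [← stdPhiCDF_sub] at h
  linarith

lemma hasDerivAt_stdPhiCDF (x : ℝ) : HasDerivAt stdPhiCDF (stdPhi x) x := by
  have h := (continuous_stdPhi.integral_hasStrictDerivAt 0 x).hasDerivAt.add_const (stdPhiCDF 0)
  refine h.congr_of_eventuallyEq (Filter.Eventually.of_forall fun y => ?_)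
  simp only [← stdPhiCDF_sub]
  ring

/-- If `g` vanishes at `0` with nonzero derivative there, then `g (t x) / g x → t`. -/
lemma tendsto_div_of_hasDerivAt_zero {g : ℝ → ℝ} {c : ℝ} (hg : HasDerivAt g c 0) (h0 : g 0 = 0)
    (hc : c ≠ 0) (t : ℝ) :
    Tendsto (fun x => g (t * x) / g x) (𝓝[≠] (0 : ℝ)) (𝓝 t) := by
  have hgt : HasDerivAt (fun x => g (t * x)) (c * t) 0 := by
    have h1 : HasDerivAt (fun x : ℝ => t * x) t 0 := by
      simpa using (hasDerivAt_id (0 : ℝ)).const_mul t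
    exact HasDerivAt.comp (h₂ := g) 0 (by simpa using hg) h1
  have hlim := (hasDerivAt_iff_tendsto_slope_zero.1 hgt).div
    (hasDerivAt_iff_tendsto_slope_zero.1 hg) hc
  rw [mul_div_cancel_left₀ t hc] at hlim
  refine hlim.congr' ?_
  filter_upwards [self_mem_nhdsWithin] with x hx
  have hx : x ≠ 0 := hx
  simp only [Pi.div_apply, zero_add, mul_zero, h0, sub_zero, smul_eq_mul]
  exact mul_div_mul_left _ _ (inv_ne_zero hx)

/-- The upper tail of the truncated normal distribution at distance `x` below `τu`. -/
lemma one_sub_truncNormalCDF {μ σ τl τu x : ℝ} (hσ : 0 < σ) (h : τl < τu) (hx : 0 ≤ x)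
    (hx' : x ≤ τu - τl) :
    1 - truncNormalCDF μ σ τl τu (τu - x) =
      (stdPhiCDF ((τu - μ) / σ) - stdPhiCDF ((τu - x - μ) / σ)) /
        (stdPhiCDF ((τu - μ) / σ) - stdPhiCDF ((τl - μ) / σ)) := by
  have hD : stdPhiCDF ((τl - μ) / σ) < stdPhiCDF ((τu - μ) / σ) :=
    stdPhiCDF_strictMono (by gcongr)
  have hD' := (sub_pos.2 hD).ne'
  rw [truncNormalCDF, if_neg (by linarith), if_neg (by linarith)]
  field_simp
  ring

/-- For the CDF `F` of `TN(μ,σ,τ_l,τ_u)` and every `t > 0`,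
`(1 − F(τ_u − t x))/(1 − F(τ_u − x)) → t` as `x → 0⁺`. -/
theorem stmt11 (μ σ τl τu : ℝ) (hσ : 0 < σ) (h : τl < τu) (t : ℝ) (ht : 0 < t) :
    Tendsto (fun x : ℝ =>
        (1 - truncNormalCDF μ σ τl τu (τu - t * x)) / (1 - truncNormalCDF μ σ τl τu (τu - x)))
      (𝓝[>] (0 : ℝ)) (𝓝 t) := by
  have hD : 0 < stdPhiCDF ((τu - μ) / σ) - stdPhiCDF ((τl - μ) / σ) :=
    sub_pos.2 (stdPhiCDF_strictMono (by gcongr))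
  set D := stdPhiCDF ((τu - μ) / σ) - stdPhiCDF ((τl - μ) / σ)
  have hlin : HasDerivAt (fun x : ℝ => (τu - x - μ) / σ) (-1 / σ) 0 :=
    (((hasDerivAt_id (0 : ℝ)).const_sub τu).sub_const μ).div_const σ
  have hg := ((HasDerivAt.comp (0 : ℝ) (hasDerivAt_stdPhiCDF _) hlin).const_sub
    (stdPhiCDF ((τu - μ) / σ))).div_const D
  have hc : -(stdPhi ((τu - 0 - μ) / σ) * (-1 / σ)) / D ≠ 0 := by
    have := stdPhi_pos ((τu - 0 - μ) / σ)
    rw [neg_div σ 1, mul_neg, neg_neg]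
    positivity
  have hlim := (tendsto_div_of_hasDerivAt_zero hg (by simp) hc t).mono_left
    (nhdsWithin_mono 0 fun x (hx : 0 < x) => hx.ne')
  refine hlim.congr' ?_
  have hpos : 0 < τu - τl := sub_pos.2 h
  filter_upwards [Ioo_mem_nhdsGT hpos, Ioo_mem_nhdsGT (div_pos hpos ht)] with x hx hxt
  have hxt' : t * x ≤ τu - τl := by
    have := (lt_div_iff₀ ht).1 hxt.2
    linarith
  rw [one_sub_truncNormalCDF hσ h hx.1.le hx.2.le,
    one_sub_truncNormalCDF hσ h (mul_pos ht hx.1).le hxt']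
  rfl
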